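/- There exists a nonzero constant κ ∈ ℂ such that (Fu)(x) = κ·det Wr(φ^β_1, …, φ^β_N, u)(x) for every entire function u and every x ∈ ℂ. In particular, writing Fu = Σ_{k=0}^N C_k(x)·u^{(k)} with polynomial coefficients C_k, the leading coefficient satisfies C_N(x) = ±V^r·∏_{i=1}^n (x − λ_i); that is, the τ-polynomial of the β-transformed data equals q(x) = ∏_{i=1}^n (x − λ_i), whose roots are the original points λ_1, …, λ_n (the statement τ^β = q and ♭K̄ = K̄^β). -/

import Mathlib

open scoped BigOperators

/-- The generalized Airy operator `L₀ u = u^(r) - ∑_{k=1}^{r-2} a_k u^(k) - x·u`. -/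
noncomputable def airyOp (r : ℕ) (a : ℕ → ℂ) (u : ℂ → ℂ) : ℂ → ℂ :=
  fun x => iteratedDeriv r u x
    - (∑ k ∈ Finset.Ico 1 (r - 1), a k * iteratedDeriv k u x) - x * u x

/-- The Wronskian determinant of an `m`-tuple of functions. -/
noncomputable def wrDet (m : ℕ) (g : Fin m → ℂ → ℂ) (x : ℂ) : ℂ :=
  Matrix.det (Matrix.of fun k s : Fin m => iteratedDeriv k.val (g s) x)

/-- The bordered Wronskian determinant `det Wr(g₁, …, g_m, u)`. -/
noncomputable def wrDetB (m : ℕ) (g : Fin m → ℂ → ℂ) (u : ℂ → ℂ) (x : ℂ) : ℂ :=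
  wrDet (m + 1) (Fin.snoc g u) x

/-- The family `φ_{i,j}(x) = γ_i·f_j(x+λ_i) + f_j'(x+λ_i)`, listed in a fixed order
as `φ_1, …, φ_N` with `N = r·n` (index `k` corresponds to `i = k / r`, `j = k % r`). -/
noncomputable def phiFam (r n : ℕ) (f : ℕ → ℂ → ℂ) (lam gam : ℕ → ℂ) :
    Fin (r * n) → ℂ → ℂ :=
  fun k x => gam (k.val / r) * f (k.val % r) (x + lam (k.val / r)) +
    deriv (f (k.val % r)) (x + lam (k.val / r))

/-- The Vandermonde-type product `V = ∏_{i<j} (λ_i - λ_j)`. -/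
noncomputable def vand (n : ℕ) (lam : ℕ → ℂ) : ℂ :=
  ∏ i ∈ Finset.range n, ∏ j ∈ Finset.Ico (i + 1) n, (lam i - lam j)

/-- The polynomial `p` evaluated at the operator `L₀`. -/
noncomputable def polyOpAiry (r : ℕ) (a : ℕ → ℂ) (p : Polynomial ℂ) (u : ℂ → ℂ) : ℂ → ℂ :=
  fun x => ∑ k ∈ Finset.range (p.natDegree + 1), p.coeff k * (airyOp r a)^[k] u x

/-- The index set of pairs `(i,j)` with `i ≤ n`, `j ≤ r-1` and `i·r + j ≤ N = r·n`. -/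
def idxSet (r n : ℕ) : Finset (ℕ × ℕ) :=
  (Finset.range (n + 1) ×ˢ Finset.range r).filter fun q => q.1 * r + q.2 ≤ r * n

/-- `K` is the (unique) family of polynomial coefficients expressing the Wronskian
operator `u ↦ det Wr(φ₁, …, φ_N, u)` as `∑ K_{i,j}(x)·(d/dx)^j (L₀^i u)(x)`. -/
def ExpProp (r n : ℕ) (a : ℕ → ℂ) (φ : Fin (r * n) → ℂ → ℂ)
    (K : ℕ → ℕ → Polynomial ℂ) : Prop :=
  (∀ i j : ℕ, (i, j) ∉ idxSet r n → K i j = 0) ∧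
  ∀ u : ℂ → ℂ, Differentiable ℂ u → ∀ x : ℂ,
    wrDetB (r * n) φ u x =
      ∑ q ∈ idxSet r n, (K q.1 q.2).eval x * iteratedDeriv q.2 ((airyOp r a)^[q.1] u) x

/-- The ♭-transformed operator `F u = ∑_{i,j} x^i·(d/dx)^j (K_{i,j}(L₀) u)`. -/
noncomputable def Fop (r n : ℕ) (a : ℕ → ℂ) (K : ℕ → ℕ → Polynomial ℂ)
    (u : ℂ → ℂ) : ℂ → ℂ :=
  fun x => ∑ q ∈ idxSet r n, x ^ q.1 * iteratedDeriv q.2 (polyOpAiry r a (K q.1 q.2) u) x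

open Polynomial

section EntireFunctions

lemma Differentiable.iteratedDeriv_complex {u : ℂ → ℂ} (hu : Differentiable ℂ u) (k : ℕ) :
    Differentiable ℂ (iteratedDeriv k u) :=
  (hu.contDiff (n := ⊤)).differentiable_iteratedDeriv k (WithTop.coe_lt_top _)

lemma differentiable_deriv_complex {u : ℂ → ℂ} (hu : Differentiable ℂ u) :
    Differentiable ℂ (deriv u) := by
  simpa [iteratedDeriv_one] using hu.iteratedDeriv_complex 1

lemma Differentiable.hasDerivAt_iteratedDeriv {u : ℂ → ℂ} (hu : Differentiable ℂ u) (k : ℕ)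
    (x : ℂ) : HasDerivAt (iteratedDeriv k u) (iteratedDeriv (k + 1) u x) x := by
  rw [iteratedDeriv_succ]
  exact (hu.iteratedDeriv_complex k x).hasDerivAt

lemma iteratedDeriv_iteratedDeriv (j k : ℕ) (u : ℂ → ℂ) :
    iteratedDeriv j (iteratedDeriv k u) = iteratedDeriv (j + k) u := by
  simp only [iteratedDeriv_eq_iterate, Function.iterate_add, Function.comp_apply]

lemma iteratedDeriv_lin_comb_shift {f : ℂ → ℂ} (hf : Differentiable ℂ f) (α β μ : ℂ) (j : ℕ)
    (x : ℂ) :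
    iteratedDeriv j (fun x => α * f (x + μ) + β * deriv f (x + μ)) x =
      α * iteratedDeriv j f (x + μ) + β * iteratedDeriv (j + 1) f (x + μ) := by
  have h1 : Differentiable ℂ fun x => f (x + μ) := hf.comp (differentiable_id.add_const μ)
  have h2 : Differentiable ℂ fun x => deriv f (x + μ) :=
    (differentiable_deriv_complex hf).comp (differentiable_id.add_const μ)
  rw [iteratedDeriv_fun_add (h1.const_mul α).contDiff.contDiffAt
    (h2.const_mul β).contDiff.contDiffAt, iteratedDeriv_const_mul_field,
    iteratedDeriv_const_mul_field, iteratedDeriv_comp_add_const, iteratedDeriv_comp_add_const,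
    iteratedDeriv_succ']

/-- The Taylor monomial of degree `m` centred at `x₀`. -/
noncomputable def taylorMonomial (x₀ : ℂ) (m : ℕ) (z : ℂ) : ℂ :=
  (m.factorial : ℂ)⁻¹ * (z - x₀) ^ m

lemma differentiable_taylorMonomial (x₀ : ℂ) (m : ℕ) : Differentiable ℂ (taylorMonomial x₀ m) := by
  unfold taylorMonomial
  fun_prop

lemma iteratedDeriv_taylorMonomial (x₀ : ℂ) (m k : ℕ) :
    iteratedDeriv k (taylorMonomial x₀ m) x₀ = if k = m then 1 else 0 := by
  have h := congrFun (iteratedDeriv_comp_sub_const k (fun z : ℂ => z ^ m) x₀) x₀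
  unfold taylorMonomial
  rw [iteratedDeriv_const_mul_field]
  simp only [sub_self] at h
  rw [h, iteratedDeriv_fun_pow_zero]
  split_ifs with h1
  · subst h1
    simp [Nat.factorial_ne_zero]
  · simp

/-- Every finite jet is the jet of an entire function. -/
lemma exists_entire_jet (M : ℕ) (x₀ : ℂ) (y : ℕ → ℂ) :
    ∃ u : ℂ → ℂ, Differentiable ℂ u ∧ ∀ k < M, iteratedDeriv k u x₀ = y k := by
  have hd : ∀ m, Differentiable ℂ fun z => y m * taylorMonomial x₀ m z := fun m =>
    (differentiable_taylorMonomial x₀ m).const_mul _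
  refine ⟨fun z => ∑ m ∈ Finset.range M, y m * taylorMonomial x₀ m z, ?_, fun k hk => ?_⟩
  · exact Differentiable.fun_sum fun m _ => hd m
  · rw [iteratedDeriv_fun_sum fun m _ => (hd m).contDiff.contDiffAt]
    simp [iteratedDeriv_const_mul_field, iteratedDeriv_taylorMonomial, hk]

end EntireFunctions

section DifferentialOperators

/-- `P` acts on entire functions as the differential operator `∑_{k ≤ m} t_k(x) (d/dx)^k`. -/
def HasSymbol (m : ℕ) (t : ℕ → ℂ[X]) (P : (ℂ → ℂ) → ℂ → ℂ) : Prop :=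
  ∀ u : ℂ → ℂ, Differentiable ℂ u → ∀ x : ℂ,
    P u x = ∑ k ∈ Finset.range (m + 1), (t k).eval x * iteratedDeriv k u x

/-- `P` is a polynomial differential operator of order at most `m` whose coefficient of
`(d/dx)^m` is `p`. -/
def IsDiffOp (m : ℕ) (p : ℂ[X]) (P : (ℂ → ℂ) → ℂ → ℂ) : Prop :=
  ∃ t : ℕ → ℂ[X], t m = p ∧ HasSymbol m t P

variable {m : ℕ} {p : ℂ[X]} {P : (ℂ → ℂ) → ℂ → ℂ}

lemma HasSymbol.differentiable {t : ℕ → ℂ[X]} (h : HasSymbol m t P) {u : ℂ → ℂ}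
    (hu : Differentiable ℂ u) : Differentiable ℂ (P u) := by
  rw [show P u = _ from funext (h u hu)]
  exact Differentiable.fun_sum fun k _ => (t k).differentiable.mul (hu.iteratedDeriv_complex k)

lemma HasSymbol.hasDerivAt {t : ℕ → ℂ[X]} (h : HasSymbol m t P) {u : ℂ → ℂ}
    (hu : Differentiable ℂ u) (x : ℂ) :
    HasDerivAt (P u) (∑ k ∈ Finset.range (m + 1), ((t k).derivative.eval x * iteratedDeriv k u x
      + (t k).eval x * iteratedDeriv (k + 1) u x)) x := by
  rw [show P u = _ from funext (h u hu)]
  exact HasDerivAt.fun_sum fun k _ => ((t k).hasDerivAt x).mul (hu.hasDerivAt_iteratedDeriv k x)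

lemma HasSymbol.apply_taylorMonomial {t : ℕ → ℂ[X]} (h : HasSymbol m t P) {k : ℕ} (hk : k ≤ m)
    (x : ℂ) : P (taylorMonomial x k) x = (t k).eval x := by
  rw [h _ (differentiable_taylorMonomial x k)]
  simp only [iteratedDeriv_taylorMonomial]
  simp
  omega

lemma HasSymbol.congr_coeff {t t' : ℕ → ℂ[X]} (h : HasSymbol m t P) (h' : HasSymbol m t' P)
    {k : ℕ} (hk : k ≤ m) : t k = t' k :=
  Polynomial.funext fun x => by rw [← h.apply_taylorMonomial hk, h'.apply_taylorMonomial hk]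

lemma IsDiffOp.differentiable (h : IsDiffOp m p P) {u : ℂ → ℂ} (hu : Differentiable ℂ u) :
    Differentiable ℂ (P u) := by
  obtain ⟨t, -, ht⟩ := h
  exact ht.differentiable hu

lemma IsDiffOp.congr {Q : (ℂ → ℂ) → ℂ → ℂ} (h : IsDiffOp m p P)
    (hQ : ∀ u, Differentiable ℂ u → ∀ x, Q u x = P u x) : IsDiffOp m p Q := by
  obtain ⟨t, h1, h2⟩ := h
  exact ⟨t, h1, fun u hu x => (hQ u hu x).trans (h2 u hu x)⟩

lemma IsDiffOp.of_lt (h : IsDiffOp m p P) {m' : ℕ} (hm : m < m') : IsDiffOp m' 0 P := by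
  obtain ⟨t, -, ht⟩ := h
  refine ⟨fun k => if k ≤ m then t k else 0, by simp [hm.not_ge], fun u hu x => ?_⟩
  rw [ht u hu x]
  have hsub : Finset.range (m + 1) ⊆ Finset.range (m' + 1) :=
    Finset.range_subset_range.2 (by omega)
  rw [← Finset.sum_subset hsub]
  · refine Finset.sum_congr rfl fun k hk => ?_
    simp only [if_pos (Nat.lt_succ_iff.1 (Finset.mem_range.1 hk))]
  · intro k _ hk
    have hk' : ¬ k ≤ m := by simpa using hk
    simp [hk']

lemma isDiffOp_zero (m : ℕ) : IsDiffOp m 0 fun _ _ => 0 :=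
  ⟨0, rfl, fun u _ x => by simp⟩

lemma isDiffOp_id : IsDiffOp 0 1 fun u => u :=
  ⟨fun _ => 1, rfl, fun u _ x => by simp⟩

lemma IsDiffOp.add {q : ℂ[X]} {Q : (ℂ → ℂ) → ℂ → ℂ} (h : IsDiffOp m p P) (h' : IsDiffOp m q Q) :
    IsDiffOp m (p + q) fun u x => P u x + Q u x := by
  obtain ⟨t, h1, h2⟩ := h
  obtain ⟨t', h1', h2'⟩ := h'
  refine ⟨t + t', by simp [h1, h1'], fun u hu x => ?_⟩
  simp [h2 u hu x, h2' u hu x, add_mul, Finset.sum_add_distrib]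

lemma IsDiffOp.poly_mul (h : IsDiffOp m p P) (q : ℂ[X]) :
    IsDiffOp m (q * p) fun u x => q.eval x * P u x := by
  obtain ⟨t, h1, h2⟩ := h
  refine ⟨fun k => q * t k, by simp [h1], fun u hu x => ?_⟩
  simp [h2 u hu x, Finset.mul_sum, mul_assoc]

lemma IsDiffOp.sum {ι : Type*} (s : Finset ι) {p : ι → ℂ[X]} {P : ι → (ℂ → ℂ) → ℂ → ℂ}
    (h : ∀ i ∈ s, IsDiffOp m (p i) (P i)) :
    IsDiffOp m (∑ i ∈ s, p i) fun u x => ∑ i ∈ s, P i u x := by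
  classical
  induction s using Finset.induction_on with
  | empty => simpa using isDiffOp_zero m
  | insert i s hi ih =>
    simp only [Finset.sum_insert hi]
    exact (h i (by simp)).add (ih fun j hj => h j (by simp [hj]))

lemma IsDiffOp.deriv (h : IsDiffOp m p P) : IsDiffOp (m + 1) p fun u => deriv (P u) := by
  obtain ⟨t, h1, h2⟩ := h
  refine ⟨fun k => (if k ≤ m then (t k).derivative else 0) + (if k = 0 then 0 else t (k - 1)),
    by simp [h1], fun u hu x => ?_⟩
  refine (h2.hasDerivAt hu x).deriv.trans ?_
  simp only [eval_add, add_mul, Finset.sum_add_distrib]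
  congr 1
  · rw [Finset.sum_range_succ _ (m + 1)]
    simp only [Nat.not_succ_le_self, if_false, eval_zero, zero_mul, add_zero]
    refine Finset.sum_congr rfl fun k hk => ?_
    rw [if_pos (Nat.lt_succ_iff.1 (Finset.mem_range.1 hk))]
  · rw [Finset.sum_range_succ' _ (m + 1)]
    simp

lemma IsDiffOp.iteratedDeriv (h : IsDiffOp m p P) (j : ℕ) :
    IsDiffOp (m + j) p fun u => iteratedDeriv j (P u) := by
  induction j with
  | zero => simpa using h
  | succ j ih => simpa only [iteratedDeriv_succ, ← add_assoc] using ih.deriv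

lemma IsDiffOp.airyOp {r : ℕ} (hr : 2 ≤ r) (a : ℕ → ℂ) (h : IsDiffOp m p P) :
    IsDiffOp (m + r) p fun u => airyOp r a (P u) := by
  have h1 := h.iteratedDeriv r
  have h2 : IsDiffOp (m + r) (∑ k ∈ Finset.Ico 1 (r - 1), C (-a k) * 0)
      fun u x => ∑ k ∈ Finset.Ico 1 (r - 1),
        (C (-a k)).eval x * _root_.iteratedDeriv k (P u) x :=
    IsDiffOp.sum _ fun k hk => by
      have hk' := Finset.mem_Ico.1 hk
      exact ((h.iteratedDeriv k).of_lt (by omega)).poly_mul _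
  have h3 := (h.of_lt (m' := m + r) (by omega)).poly_mul (-X)
  have h4 := (h1.add h2).add h3
  simp only [mul_zero, Finset.sum_const_zero, add_zero] at h4
  refine h4.congr fun u _ x => ?_
  simp [_root_.airyOp, sub_eq_add_neg]

lemma isDiffOp_iteratedDeriv_airyOp {r : ℕ} (hr : 2 ≤ r) (a : ℕ → ℂ) (i j : ℕ) :
    IsDiffOp (i * r + j) 1 fun u => iteratedDeriv j ((airyOp r a)^[i] u) := by
  refine IsDiffOp.iteratedDeriv (P := (airyOp r a)^[i]) ?_ j
  induction i with
  | zero =>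
    rw [Nat.zero_mul, Function.iterate_zero]
    exact isDiffOp_id
  | succ i ih =>
    rw [Nat.succ_mul]
    exact (ih.airyOp hr a).congr fun _ _ _ => by rw [Function.iterate_succ_apply']

lemma differentiable_airyOp_iterate {r : ℕ} (hr : 2 ≤ r) (a : ℕ → ℂ) (i : ℕ) {u : ℂ → ℂ}
    (hu : Differentiable ℂ u) : Differentiable ℂ ((airyOp r a)^[i] u) := by
  simpa using (isDiffOp_iteratedDeriv_airyOp hr a i 0).differentiable hu

end DifferentialOperators

section Wronskians

lemma snoc_differentiable {N : ℕ} {g : Fin N → ℂ → ℂ} (hg : ∀ s, Differentiable ℂ (g s))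
    {u : ℂ → ℂ} (hu : Differentiable ℂ u) (s : Fin (N + 1)) :
    Differentiable ℂ ((Fin.snoc g u : Fin (N + 1) → ℂ → ℂ) s) := by
  induction s using Fin.lastCases with
  | last => simpa using hu
  | cast s => simpa using hg s

lemma HasSymbol.wronskian_row {N : ℕ} {t : ℕ → ℂ[X]} {P : (ℂ → ℂ) → ℂ → ℂ}
    (hP : HasSymbol N t P) {g : Fin (N + 1) → ℂ → ℂ} (hg : ∀ s, Differentiable ℂ (g s)) (x : ℂ) :
    ∑ k : Fin (N + 1), (t k).eval x •
      (Matrix.of fun k s : Fin (N + 1) => iteratedDeriv k.val (g s) x) k = fun s => P (g s) x := by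
  ext s
  rw [hP _ (hg s), Finset.sum_range]
  simp

/-- Cramer's rule for a differential operator annihilating the functions `g_s` at a point. -/
lemma HasSymbol.mul_wrDetB {N : ℕ} {t : ℕ → ℂ[X]} {P : (ℂ → ℂ) → ℂ → ℂ} (hP : HasSymbol N t P)
    {g : Fin N → ℂ → ℂ} (hg : ∀ s, Differentiable ℂ (g s)) {u : ℂ → ℂ} (hu : Differentiable ℂ u)
    (x : ℂ) (h : ∀ s, P (g s) x = 0) :
    (t N).eval x * wrDetB N g u x = wrDet N g x * P u x := by
  have h1 := Matrix.det_updateRow_sum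
    (Matrix.of fun k s : Fin (N + 1) =>
      iteratedDeriv k.val ((Fin.snoc g u : Fin (N + 1) → ℂ → ℂ) s) x)
    (Fin.last N) (fun k => (t k).eval x)
  rw [hP.wronskian_row (snoc_differentiable hg hu)] at h1
  rw [wrDetB, wrDet, wrDet]
  rw [Fin.val_last, smul_eq_mul] at h1
  rw [← h1, Matrix.det_succ_row _ (Fin.last N), Fin.sum_univ_castSucc,
    Finset.sum_eq_zero fun s _ => by simp [h s]]
  simp only [Matrix.updateRow_self, Fin.snoc_last, zero_add, ← two_mul, pow_mul, neg_one_sq,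
    one_pow, one_mul, Fin.succAbove_last]
  rw [mul_comm]
  congr 2
  ext k s
  simp

lemma wrDetB_taylorMonomial (N : ℕ) (g : Fin N → ℂ → ℂ) (x : ℂ) :
    wrDetB N g (taylorMonomial x N) x = wrDet N g x := by
  rw [wrDetB, wrDet, Matrix.det_succ_column _ (Fin.last N), Fin.sum_univ_castSucc,
    Finset.sum_eq_zero fun s _ => by simp [iteratedDeriv_taylorMonomial, s.isLt.ne]]
  simp only [Matrix.of_apply, Fin.snoc_last, zero_add, ← two_mul, pow_mul, neg_one_sq,
    one_pow, one_mul, Fin.succAbove_last, Fin.val_last, iteratedDeriv_taylorMonomial, if_true]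
  rw [wrDet]
  congr 1
  ext k s
  simp

lemma wrDetB_self {N : ℕ} (g : Fin N → ℂ → ℂ) (s : Fin N) (x : ℂ) : wrDetB N g (g s) x = 0 :=
  Matrix.det_zero_of_column_eq (i := s.castSucc) (j := Fin.last N) (Fin.castSucc_lt_last s).ne
    fun k => by simp

end Wronskians

section AiryKernel

variable {r : ℕ} {a : ℕ → ℂ} {f : ℂ → ℂ}

lemma iteratedDeriv_id_mul {f : ℂ → ℂ} (hf : Differentiable ℂ f) (k : ℕ) :
    iteratedDeriv k (fun x => x * f x) =
      fun x => x * iteratedDeriv k f x + k * iteratedDeriv (k - 1) f x := by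
  induction k with
  | zero => simp
  | succ k ih =>
    ext x
    rw [iteratedDeriv_succ, ih]
    have h1 := (hasDerivAt_id x).mul (hf.hasDerivAt_iteratedDeriv k x)
    have h2 := (hf.hasDerivAt_iteratedDeriv (k - 1) x).const_mul (k : ℂ)
    have h3 : (k : ℂ) * iteratedDeriv (k - 1 + 1) f x = k * iteratedDeriv k f x := by
      cases k <;> simp
    refine (h1.add h2).deriv.trans ?_
    rw [h3]
    simp
    ring

/-- The `k`-th derivative of the generalized Airy equation. -/
lemma iteratedDeriv_of_airyOp_eq_zero (hf : Differentiable ℂ f) (hker : ∀ x, airyOp r a f x = 0)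
    (k : ℕ) (x : ℂ) :
    iteratedDeriv (k + r) f x = ∑ l ∈ Finset.Ico 1 (r - 1), a l * iteratedDeriv (k + l) f x
      + (x * iteratedDeriv k f x + k * iteratedDeriv (k - 1) f x) := by
  have h : iteratedDeriv r f =
      fun x => (∑ l ∈ Finset.Ico 1 (r - 1), a l * iteratedDeriv l f x) + x * f x := by
    ext x
    have := hker x
    rw [airyOp] at this
    linear_combination this
  rw [← iteratedDeriv_iteratedDeriv, h]
  have hd : ∀ l, Differentiable ℂ fun x => a l * iteratedDeriv l f x := fun l =>
    (hf.iteratedDeriv_complex l).const_mul _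
  have hd' : Differentiable ℂ fun x => ∑ l ∈ Finset.Ico 1 (r - 1), a l * iteratedDeriv l f x :=
    Differentiable.fun_sum fun l _ => hd l
  rw [iteratedDeriv_fun_add hd'.contDiff.contDiffAt (differentiable_fun_id.fun_mul hf).contDiff.contDiffAt,
    iteratedDeriv_fun_sum fun l _ => (hd l).contDiff.contDiffAt, iteratedDeriv_id_mul hf]
  congr 1
  refine Finset.sum_congr rfl fun l _ => ?_
  rw [iteratedDeriv_const_mul_field, iteratedDeriv_iteratedDeriv]

/-- A constant coefficient operator annihilating a nonzero element of the Airy kernel is zero. -/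
lemma eq_zero_of_constCoeff_annihilates (hf : Differentiable ℂ f)
    (hker : ∀ x, airyOp r a f x = 0) {x₀ : ℂ} (hx₀ : f x₀ ≠ 0) (M : ℕ) (p : ℂ[X])
    (hp : p.natDegree ≤ M)
    (h : ∀ x, ∑ k ∈ Finset.range (M + 1), p.coeff k * iteratedDeriv k f x = 0) : p = 0 := by
  induction M generalizing p with
  | zero =>
    rw [eq_C_of_natDegree_le_zero hp]
    have := h x₀
    simp only [zero_add, Finset.sum_range_one, iteratedDeriv_zero, mul_eq_zero, hx₀, or_false]
      at this
    simp [this]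
  | succ M ih =>
    have hD : ∀ l x, ∑ k ∈ Finset.range (M + 1 + 1), p.coeff k * iteratedDeriv (k + l) f x = 0 := by
      intro l x
      have h0 : (fun x => ∑ k ∈ Finset.range (M + 1 + 1), p.coeff k * iteratedDeriv k f x) =
        fun _ => 0 := funext h
      have hd : ∀ k, Differentiable ℂ fun x => p.coeff k * iteratedDeriv k f x := fun k =>
        (hf.iteratedDeriv_complex k).const_mul _
      have h1 := congrFun (congrArg (iteratedDeriv l) h0) x
      rw [iteratedDeriv_fun_sum fun k _ => (hd k).contDiff.contDiffAt] at h1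
      simpa [iteratedDeriv_const_mul_field, iteratedDeriv_iteratedDeriv, add_comm l] using h1
    have hp' : derivative p = 0 := by
      refine ih _ ((natDegree_derivative_le p).trans (by omega)) fun x => ?_
      have h1 := hD r x
      simp only [iteratedDeriv_of_airyOp_eq_zero hf hker, mul_add, Finset.sum_add_distrib,
        Finset.mul_sum] at h1
      rw [Finset.sum_comm] at h1
      have h2 : ∀ l, ∑ k ∈ Finset.range (M + 1 + 1), p.coeff k * (a l * iteratedDeriv (k + l) f x)
          = 0 := fun l => by
        simp_rw [mul_left_comm _ (a l), ← Finset.mul_sum, hD l x, mul_zero]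
      have h3 : ∑ k ∈ Finset.range (M + 1 + 1), p.coeff k * (x * iteratedDeriv k f x) = 0 := by
        simp_rw [mul_left_comm _ x, ← Finset.mul_sum, h x, mul_zero]
      rw [Finset.sum_eq_zero fun l _ => h2 l, h3, zero_add, zero_add, Finset.sum_range_succ'] at h1
      rw [← h1]
      simp [coeff_derivative, mul_assoc]
    rw [eq_C_of_derivative_eq_zero hp'] at h ⊢
    have := h x₀
    rw [Finset.sum_range_succ'] at this
    simpa [coeff_C_of_ne_zero, hx₀] using this

lemma airyOp_lin_comb_shift (hf : Differentiable ℂ f) (hker : ∀ x, airyOp r a f x = 0)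
    (α β μ : ℂ) :
    airyOp r a (fun x => α * f (x + μ) + β * deriv f (x + μ)) =
      fun x => (α * μ + β) * f (x + μ) + β * μ * deriv f (x + μ) := by
  ext x
  have h0 := iteratedDeriv_of_airyOp_eq_zero hf hker 0 (x + μ)
  have h1 := iteratedDeriv_of_airyOp_eq_zero hf hker 1 (x + μ)
  simp only [airyOp, iteratedDeriv_lin_comb_shift hf]
  rw [add_comm r 1, h1]
  simp only [zero_add, iteratedDeriv_zero, iteratedDeriv_one, Nat.cast_zero, Nat.cast_one,
    zero_mul, add_zero, Nat.sub_self] at h0 ⊢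
  rw [h0]
  simp only [mul_add, Finset.sum_add_distrib, Finset.mul_sum, mul_left_comm (a _), add_comm 1]
  ring

lemma airyOp_iterate_lin_comb_shift (hf : Differentiable ℂ f) (hker : ∀ x, airyOp r a f x = 0)
    (α β μ : ℂ) (i : ℕ) :
    (airyOp r a)^[i] (fun x => α * f (x + μ) + β * deriv f (x + μ)) =
      fun x => (α * μ ^ i + β * (i * μ ^ (i - 1))) * f (x + μ) + β * μ ^ i * deriv f (x + μ) := by
  induction i with
  | zero => simp
  | succ i ih =>
    rw [Function.iterate_succ_apply', ih, airyOp_lin_comb_shift hf hker]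
    ext x
    have h : (i : ℂ) * μ ^ (i - 1) * μ = i * μ ^ i := by
      cases i <;> simp [pow_succ, mul_assoc]
    rw [pow_succ, Nat.add_sub_cancel]
    push_cast
    linear_combination β * f (x + μ) * h

lemma iteratedDeriv_airyOp_iterate_lin_comb_shift (hf : Differentiable ℂ f)
    (hker : ∀ x, airyOp r a f x = 0) (α β μ : ℂ) (i j : ℕ) (x : ℂ) :
    iteratedDeriv j ((airyOp r a)^[i] (fun x => α * f (x + μ) + β * deriv f (x + μ))) x =
      (α * μ ^ i + β * (i * μ ^ (i - 1))) * iteratedDeriv j f (x + μ)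
        + β * μ ^ i * iteratedDeriv (j + 1) f (x + μ) := by
  rw [airyOp_iterate_lin_comb_shift hf hker, iteratedDeriv_lin_comb_shift hf]

lemma polyOpAiry_lin_comb_shift (hf : Differentiable ℂ f) (hker : ∀ x, airyOp r a f x = 0)
    (p : ℂ[X]) (α β μ : ℂ) :
    polyOpAiry r a p (fun x => α * f (x + μ) + β * deriv f (x + μ)) =
      fun x => (α * p.eval μ + β * p.derivative.eval μ) * f (x + μ)
        + β * p.eval μ * deriv f (x + μ) := by
  ext x
  simp only [polyOpAiry, airyOp_iterate_lin_comb_shift hf hker]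
  have h1 := eval_eq_sum_range (p := p) μ
  have h2 : p.derivative.eval μ =
      ∑ k ∈ Finset.range (p.natDegree + 1), p.coeff k * (k * μ ^ (k - 1)) := by
    rw [derivative_eval, sum_over_range _ (by simp)]
    simp [mul_assoc]
  rw [h1, h2]
  simp only [mul_add, add_mul, Finset.sum_add_distrib, Finset.mul_sum, Finset.sum_mul]
  congr 1
  · congr 1 <;> exact Finset.sum_congr rfl fun k _ => by ring
  · exact Finset.sum_congr rfl fun k _ => by ring

end AiryKernel

section Determinants

/-- Degree and top coefficient of a determinant whose entries have degrees bounded row by row. -/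
lemma det_natDegree_le_and_coeff {ι R : Type*} [Fintype ι] [DecidableEq ι] [CommRing R]
    (M : Matrix ι ι R[X]) (d : ι → ℕ) (h : ∀ p q, (M p q).natDegree ≤ d p) :
    M.det.natDegree ≤ ∑ p, d p ∧
      M.det.coeff (∑ p, d p) = (Matrix.of fun p q => (M p q).coeff (d p)).det := by
  have key : ∀ (σ : Equiv.Perm ι) (s : Finset ι),
      (∏ q ∈ s, M (σ q) q).natDegree ≤ ∑ q ∈ s, d (σ q) ∧
        (∏ q ∈ s, M (σ q) q).coeff (∑ q ∈ s, d (σ q)) = ∏ q ∈ s, (M (σ q) q).coeff (d (σ q)) := by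
    intro σ s
    induction s using Finset.induction_on with
    | empty => simp
    | insert q s hq ih =>
      simp only [Finset.sum_insert hq, Finset.prod_insert hq]
      refine ⟨natDegree_mul_le_of_le (h _ _) ih.1, ?_⟩
      rw [coeff_mul_add_eq_of_natDegree_le (h _ _) ih.1, ih.2]
  have hsum : ∀ σ : Equiv.Perm ι, ∑ q, d (σ q) = ∑ p, d p := fun σ => Equiv.sum_comp σ d
  constructor
  · rw [Matrix.det_apply]
    refine natDegree_sum_le_of_forall_le _ _ fun σ _ => ?_
    refine (natDegree_smul_le _ _).trans ?_
    rw [← hsum σ]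
    exact (key σ Finset.univ).1
  · rw [Matrix.det_apply, Matrix.det_apply, finsetSum_coeff]
    refine Finset.sum_congr rfl fun σ _ => ?_
    rw [coeff_smul, ← hsum σ, (key σ Finset.univ).2]
    rfl

lemma exists_cyclic_shift (r : ℕ) : ∃ σ : Equiv.Perm (Fin r), ∀ j : Fin r,
    (j.val + 1 < r → (σ j).val = j.val + 1) ∧ (¬ j.val + 1 < r → (σ j).val = 0) := by
  cases r with
  | zero => exact ⟨Equiv.refl _, fun j => j.elim0⟩
  | succ r =>
    refine ⟨finRotate (r + 1), fun j => ⟨fun h => ?_, fun h => ?_⟩⟩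
    · have : j = ⟨j.val, by omega⟩ := rfl
      rw [this, finRotate_of_lt (by omega)]
    · have : j = Fin.last r := Fin.ext (by simp; omega)
      rw [this, finRotate_last]
      rfl

/-- The Vandermonde product `∏_{i<j<n} (v_j - v_i)`. -/
noncomputable def vandermondeProd (n : ℕ) (v : ℕ → ℂ) : ℂ :=
  ∏ i ∈ Finset.range n, ∏ j ∈ Finset.Ico (i + 1) n, (v j - v i)

lemma det_vandermonde_eq_vandermondeProd (n : ℕ) (v : ℕ → ℂ) :
    (Matrix.vandermonde fun i : Fin n => v i).det = vandermondeProd n v := by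
  rw [Matrix.det_vandermonde, vandermondeProd, Finset.prod_range]
  refine Finset.prod_congr rfl fun i _ => ?_
  refine Finset.prod_bij (fun j _ => j.val) ?_ ?_ ?_ ?_
  · intro j hj
    have : i < j := by simpa using hj
    exact Finset.mem_Ico.2 ⟨this, j.isLt⟩
  · intro j _ j' _ h
    exact Fin.ext h
  · intro j hj
    have hj' := Finset.mem_Ico.1 hj
    exact ⟨⟨j, hj'.2⟩, by simpa [Fin.lt_def] using hj'.1, rfl⟩
  · intro j _
    rfl

lemma vandermondeProd_update (n : ℕ) (v : ℕ → ℂ) (t : ℂ) :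
    vandermondeProd (n + 1) (Function.update v n t) =
      vandermondeProd n v * ∏ i ∈ Finset.range n, (t - v i) := by
  rw [vandermondeProd, vandermondeProd, Finset.prod_range_succ, Finset.Ico_self, Finset.prod_empty,
    mul_one, ← Finset.prod_mul_distrib]
  refine Finset.prod_congr rfl fun i hi => ?_
  have hi' := Finset.mem_range.1 hi
  rw [Finset.prod_Ico_succ_top (by omega), Function.update_self,
    Function.update_of_ne hi'.ne]
  congr 1
  refine Finset.prod_congr rfl fun j hj => ?_
  rw [Function.update_of_ne (Finset.mem_Ico.1 hj).2.ne]

lemma exists_sign_vand (n : ℕ) (v : ℕ → ℂ) :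
    ∃ s : ℂ, (s = 1 ∨ s = -1) ∧ vandermondeProd n v = s * vand n v := by
  refine ⟨∏ i ∈ Finset.range n, ∏ j ∈ Finset.Ico (i + 1) n, (-1), ?_, ?_⟩
  · simp only [Finset.prod_const, Finset.prod_pow_eq_pow_sum]
    exact neg_one_pow_eq_or ℂ _
  · rw [vandermondeProd, vand, ← Finset.prod_mul_distrib]
    refine Finset.prod_congr rfl fun i _ => ?_
    rw [← Finset.prod_mul_distrib]
    exact Finset.prod_congr rfl fun j _ => by ring

lemma vand_ne_zero {n : ℕ} {v : ℕ → ℂ} (hv : ∀ i < n, ∀ j < n, i ≠ j → v i ≠ v j) :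
    vand n v ≠ 0 := by
  refine Finset.prod_ne_zero_iff.2 fun i hi => Finset.prod_ne_zero_iff.2 fun j hj => ?_
  have hi' := Finset.mem_range.1 hi
  have hj' := Finset.mem_Ico.1 hj
  exact sub_ne_zero.2 (hv i hi' j hj'.2 (by omega))

/-- The index set of the operators `(d/dx)^j L₀^i`, `i < n`, `j < r`, together with `L₀^n`. -/
abbrev JetIdx (r n : ℕ) : Type := (Fin r × Fin n) ⊕ Fin 1

/-- The order of the derivative in the operator with the given index. -/
def JetIdx.derivOrder {r n : ℕ} (p : JetIdx r n) : ℕ := Sum.elim (fun q => q.1.val) (fun _ => 0) p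

/-- The power of `L₀` in the operator with the given index. -/
def JetIdx.airyPow {r n : ℕ} (p : JetIdx r n) : ℕ := Sum.elim (fun q => q.2.val) (fun _ => n) p

/-- The matrix of the functions `(d/dx)^j L₀^i φ_{l,s}` in terms of `f_s^{(m)}(x + λ_l)`, bordered
by the column `y`. -/
noncomputable def borderedMatrix (r n : ℕ) (a lam gam : ℕ → ℂ) (y : JetIdx r n → ℂ) :
    Matrix (JetIdx r n) (JetIdx r n) ℂ[X] :=
  Matrix.of fun p => Sum.elim
    (fun q : Fin r × Fin n =>
      C (gam q.2 * lam q.2 ^ p.airyPow + p.airyPow * lam q.2 ^ (p.airyPow - 1))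
          * (if q.1.val = p.derivOrder then 1 else 0)
        + C (lam q.2 ^ p.airyPow) * (if p.derivOrder + 1 < r then
            (if q.1.val = p.derivOrder + 1 then 1 else 0) else
            (if q.1.val = 0 then X + C (lam q.2) else 0)
              + C (if q.1.val ∈ Finset.Ico 1 (r - 1) then a q.1.val else 0)))
    (fun _ => C (y p))

/-- The matrix of top-degree coefficients of `borderedMatrix`, row by row. -/
noncomputable def leadingMatrix (r n : ℕ) (lam gam : ℕ → ℂ) (y : JetIdx r n → ℂ) :
    Matrix (JetIdx r n) (JetIdx r n) ℂ :=
  Matrix.of fun p => Sum.elim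
    (fun q : Fin r × Fin n =>
      if p.derivOrder + 1 < r then
        (gam q.2 * lam q.2 ^ p.airyPow + p.airyPow * lam q.2 ^ (p.airyPow - 1))
            * (if q.1.val = p.derivOrder then 1 else 0)
          + lam q.2 ^ p.airyPow * (if q.1.val = p.derivOrder + 1 then 1 else 0)
      else lam q.2 ^ p.airyPow * (if q.1.val = 0 then 1 else 0))
    (fun _ => if p.derivOrder + 1 < r then y p else 0)

lemma det_borderedMatrix_natDegree_le_and_coeff {r : ℕ} (hr : 2 ≤ r) (n : ℕ) (a lam gam : ℕ → ℂ)
    (y : JetIdx r n → ℂ) :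
    (borderedMatrix r n a lam gam y).det.natDegree ≤ n ∧
      (borderedMatrix r n a lam gam y).det.coeff n = (leadingMatrix r n lam gam y).det := by
  let d : JetIdx r n → ℕ := fun p => if p.derivOrder + 1 < r then 0 else 1
  have hd : ∑ p, d p = n := by
    rw [Fintype.sum_sum_type, Fintype.sum_prod_type]
    have h1 : ∀ j : Fin r, ∑ i : Fin n, d (Sum.inl (j, i)) =
        if j = ⟨r - 1, by omega⟩ then n else 0 := by
      intro j
      have : (j = ⟨r - 1, by omega⟩) ↔ ¬ j.val + 1 < r := by
        rw [Fin.ext_iff]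
        have := j.isLt
        simp only
        omega
      by_cases hj : j.val + 1 < r <;> simp [d, JetIdx.derivOrder, this, hj]
    have h2 : 1 < r := by omega
    rw [Finset.sum_congr rfl fun j _ => h1 j]
    simp [d, JetIdx.derivOrder, h2]
  have hrow : ∀ p q, (borderedMatrix r n a lam gam y p q).natDegree ≤ d p := by
    intro p q
    rcases q with q | q
    · by_cases hp : p.derivOrder + 1 < r
      · simp only [borderedMatrix, Matrix.of_apply, Sum.elim_inl, d, hp, if_true]
        split_ifs <;> compute_degree
      · simp only [borderedMatrix, Matrix.of_apply, Sum.elim_inl, d, hp, if_false]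
        split_ifs <;> compute_degree!
    · simp [borderedMatrix]
  have h := det_natDegree_le_and_coeff _ d hrow
  rw [hd] at h
  refine ⟨h.1, h.2.trans ?_⟩
  congr 1
  ext p q
  rcases q with q | q
  · simp only [borderedMatrix, leadingMatrix, Matrix.of_apply, Sum.elim_inl, d]
    generalize gam q.2 * lam q.2 ^ p.airyPow + p.airyPow * lam q.2 ^ (p.airyPow - 1) = α
    generalize lam q.2 ^ p.airyPow = β
    by_cases hp : p.derivOrder + 1 < r
    · simp only [hp, if_true]
      split_ifs <;> simp
    · simp only [hp, if_false]
      split_ifs <;> simp [-map_add]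
  · by_cases hp : p.derivOrder + 1 < r <;> simp [borderedMatrix, leadingMatrix, d, hp]

/-- The diagonal block of `leadingMatrix` containing the bordering column. -/
noncomputable def borderBlock (n : ℕ) (lam : ℕ → ℂ) (y : Fin n ⊕ Fin 1 → ℂ) :
    Matrix (Fin n ⊕ Fin 1) (Fin n ⊕ Fin 1) ℂ :=
  Matrix.of fun p q => Sum.elim
    (fun l : Fin n => lam l ^ (Sum.elim (fun i => i.val) (fun _ => n) q : ℕ)) (fun _ => y q) p

lemma det_borderBlock_pow (n : ℕ) (lam : ℕ → ℂ) (t : ℂ) :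
    (borderBlock n lam fun q => t ^ (Sum.elim (fun i => i.val) (fun _ => n) q : ℕ)).det =
      vandermondeProd n lam * ∏ i ∈ Finset.range n, (t - lam i) := by
  rw [← vandermondeProd_update, ← det_vandermonde_eq_vandermondeProd,
    ← Matrix.det_submatrix_equiv_self (finSumFinEquiv (m := n) (n := 1))]
  congr 1
  ext p q
  rcases p with p | p <;> rcases q with q | q <;>
    simp [borderBlock, Matrix.vandermonde_apply, Function.update_of_ne, p.isLt.ne]

lemma det_borderBlock_zero (n : ℕ) (lam : ℕ → ℂ) : (borderBlock n lam 0).det = 0 :=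
  Matrix.det_eq_zero_of_row_eq_zero (Sum.inr 0) fun q => by simp [borderBlock]

lemma det_borderBlock_single (n : ℕ) (lam : ℕ → ℂ) :
    (borderBlock n lam (Sum.elim 0 1)).det = vandermondeProd n lam := by
  rw [← det_vandermonde_eq_vandermondeProd]
  have : borderBlock n lam (Sum.elim 0 1) = Matrix.fromBlocks
      (Matrix.vandermonde fun i : Fin n => lam i) (Matrix.of fun l _ => lam l ^ n) 0 1 := by
    ext p q
    rcases p with p | p <;> rcases q with q | q <;>
      simp [borderBlock, Matrix.vandermonde_apply, Matrix.one_apply, eq_iff_true_of_subsingleton]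
  rw [this, Matrix.det_fromBlocks_zero₂₁, Matrix.det_one, mul_one]

lemma exists_det_leadingMatrix {r : ℕ} (hr : 2 ≤ r) (n : ℕ) (lam gam : ℕ → ℂ) :
    ∃ s : ℂ, (s = 1 ∨ s = -1) ∧ ∀ y : JetIdx r n → ℂ,
      (leadingMatrix r n lam gam y).det = s * vandermondeProd n lam ^ (r - 1) *
        (borderBlock n lam fun q => y (Sum.map (fun i => (⟨0, by omega⟩, i)) id q)).det := by
  obtain ⟨σ, hσ⟩ := exists_cyclic_shift r
  let τ : Equiv.Perm (JetIdx r n) :=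
    Equiv.sumCongr (Equiv.prodCongr σ (Equiv.refl _)) (Equiv.refl _)
  refine ⟨((Equiv.Perm.sign τ : ℤˣ) : ℤ), ?_, fun y => ?_⟩
  · rcases Int.units_eq_one_or (Equiv.Perm.sign τ) with h | h <;> simp [h]
  have hσ' : ((Equiv.Perm.sign τ : ℤˣ) : ℂ) * ((Equiv.Perm.sign τ : ℤˣ) : ℂ) = 1 := by
    rcases Int.units_eq_one_or (Equiv.Perm.sign τ) with h | h <;> simp [h]
  have hperm := Matrix.det_permute' τ (leadingMatrix r n lam gam y)
  set L := leadingMatrix r n lam gam y with hL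
  have hLdet : L.det = ((Equiv.Perm.sign τ : ℤˣ) : ℂ) * (L.submatrix id τ).transpose.det := by
    rw [Matrix.det_transpose, hperm, ← mul_assoc, hσ', one_mul]
  let one' : Fin r := ⟨1, by omega⟩
  let zero' : Fin r := ⟨0, by omega⟩
  have h1r : 1 < r := by omega
  let b : JetIdx r n → Fin r := Sum.elim (fun q => σ q.1) (fun _ => one')
  have hσ0 : σ zero' = one' := Fin.ext ((hσ zero').1 (by simp [zero']; omega))
  have htri : (L.submatrix id τ).transpose.BlockTriangular b := by
    intro p q hpq
    rw [Matrix.transpose_apply, Matrix.submatrix_apply, id]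
    have hq : (b q).val = if q.derivOrder + 1 < r then q.derivOrder + 1 else 0 := by
      rcases q with ⟨j, i⟩ | q
      · simp only [b, Sum.elim_inl, JetIdx.derivOrder]
        by_cases h : j.val + 1 < r
        · simp [h, (hσ j).1 h]
        · simp [h, (hσ j).2 h]
      · simp [b, JetIdx.derivOrder, one', h1r]
    have hlt : (b q).val < (b p).val := hpq
    rw [hq] at hlt
    rcases p with ⟨j, i⟩ | p
    · simp only [b, Sum.elim_inl] at hlt
      simp only [hL, leadingMatrix, Matrix.of_apply, τ, Equiv.sumCongr_apply, Sum.map_inl,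
        Sum.elim_inl, Equiv.prodCongr_apply, Prod.map_fst]
      split_ifs at hlt ⊢ <;> first | omega | simp
    · simp only [b, Sum.elim_inr, one'] at hlt
      simp only [hL, leadingMatrix, Matrix.of_apply, τ, Equiv.sumCongr_apply, Sum.map_inr,
        Sum.elim_inr]
      split_ifs at hlt ⊢
      · omega
      · rfl
  have hentry : ∀ (j : Fin r) (i : Fin n) (l : Fin n),
      L (Sum.inl (j, i)) (τ (Sum.inl (j, l))) = lam l ^ i.val := by
    intro j i l
    simp only [hL, leadingMatrix, Matrix.of_apply, τ, Equiv.sumCongr_apply, Sum.map_inl,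
      Sum.elim_inl, Equiv.prodCongr_apply, Prod.map_apply, JetIdx.derivOrder, JetIdx.airyPow,
      Equiv.refl_apply]
    by_cases h : j.val + 1 < r
    · simp [h, (hσ j).1 h]
    · simp [h, (hσ j).2 h]
  have hblock : ∀ k, k ≠ one' →
      ((L.submatrix id τ).transpose.toSquareBlock b k).det = vandermondeProd n lam := by
    intro k hk
    let e : Fin n → {p // b p = k} := fun i => ⟨Sum.inl (σ.symm k, i), by simp [b]⟩
    have he : Function.Bijective e := by
      constructor
      · intro i i' h
        simpa [e] using h
      · rintro ⟨⟨j, i⟩ | p, hp⟩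
        · refine ⟨i, ?_⟩
          have : σ.symm k = j := by
            rw [Equiv.symm_apply_eq]
            exact hp.symm
          simp [e, this]
        · exact absurd hp.symm hk
    rw [← Matrix.det_submatrix_equiv_self (Equiv.ofBijective e he),
      ← det_vandermonde_eq_vandermondeProd]
    congr 1
    ext l i
    exact hentry _ i l
  have hblock1 : ((L.submatrix id τ).transpose.toSquareBlock b one').det =
      (borderBlock n lam fun q => y (Sum.map (fun i => (zero', i)) id q)).det := by
    let e : Fin n ⊕ Fin 1 → {p // b p = one'} := fun q =>
      ⟨Sum.map (fun i => (zero', i)) id q, by rcases q with q | q <;> simp [b, hσ0]⟩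
    have he : Function.Bijective e := by
      constructor
      · intro q q' h
        have h' := congrArg Subtype.val h
        rcases q with q | q <;> rcases q' with q' | q' <;> simp_all [e]
      · rintro ⟨⟨j, i⟩ | p, hp⟩
        · have : j = zero' := σ.injective (by rw [hσ0]; exact hp)
          exact ⟨Sum.inl i, by simp [e, this]⟩
        · exact ⟨Sum.inr p, by simp [e]⟩
    rw [← Matrix.det_submatrix_equiv_self (Equiv.ofBijective e he)]
    congr 1
    ext p q
    rcases p with p | p <;> rcases q with q | q
    · exact hentry zero' q p
    · have : ((σ zero').val : ℕ) = 1 := by rw [hσ0]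
      simp [e, Matrix.toSquareBlock, Matrix.toSquareBlockProp, borderBlock, hL, leadingMatrix, τ,
        JetIdx.derivOrder, JetIdx.airyPow, h1r, this]
    · simp [e, Matrix.toSquareBlock, Matrix.toSquareBlockProp, borderBlock, hL, leadingMatrix, τ,
        JetIdx.derivOrder, zero', h1r]
    · simp [e, Matrix.toSquareBlock, Matrix.toSquareBlockProp, borderBlock, hL, leadingMatrix, τ,
        JetIdx.derivOrder, h1r]
  rw [hLdet, htri.det_fintype, ← Finset.mul_prod_erase _ _ (Finset.mem_univ one'), hblock1,
    Finset.prod_congr rfl fun k hk => hblock k (Finset.ne_of_mem_erase hk), Finset.prod_const,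
    Finset.card_erase_of_mem (Finset.mem_univ _), Finset.card_univ, Fintype.card_fin]
  simp only [zero']
  ring

end Determinants

section JetOperators

variable {r n : ℕ}

/-- The enumeration of the jet indices by the order of the corresponding operators. -/
def jetEquiv (r n : ℕ) : JetIdx r n ≃ Fin (r * n + 1) :=
  (Equiv.sumCongr (((Equiv.prodComm _ _).trans finProdFinEquiv).trans (finCongr (Nat.mul_comm n r)))
    (Equiv.refl (Fin 1))).trans finSumFinEquiv

lemma jetEquiv_inr (q : Fin 1) : jetEquiv r n (Sum.inr q) = Fin.last (r * n) := by
  ext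
  simp [jetEquiv]

lemma jetEquiv_inl (q : Fin r × Fin n) : ∃ k : Fin (r * n),
    jetEquiv r n (Sum.inl q) = k.castSucc ∧ k.val / r = q.2 ∧ k.val % r = q.1 := by
  have hr : 0 < r := by have := q.1.isLt; omega
  refine ⟨finCongr (Nat.mul_comm n r) (finProdFinEquiv (q.2, q.1)), rfl, ?_, ?_⟩
  · simp [Nat.add_mul_div_left _ _ hr]
  · simp [Nat.mod_eq_of_lt]

lemma jetEquiv_val (p : JetIdx r n) :
    (jetEquiv r n p).val = p.airyPow * r + p.derivOrder := by
  rcases p with q | q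
  · obtain ⟨k, hk, h1, h2⟩ := jetEquiv_inl q
    rw [hk, JetIdx.airyPow, JetIdx.derivOrder, Sum.elim_inl, Sum.elim_inl, ← h1, ← h2]
    simp [Nat.div_add_mod']
  · simp [jetEquiv_inr, JetIdx.airyPow, JetIdx.derivOrder, mul_comm]

lemma JetIdx.derivOrder_lt (hr : 0 < r) (p : JetIdx r n) : p.derivOrder < r := by
  rcases p with q | q
  · exact q.1.isLt
  · exact hr

lemma sum_idxSet (hr : 0 < r) (g : ℕ × ℕ → ℂ) :
    ∑ q ∈ idxSet r n, g q = ∑ p : JetIdx r n, g (p.airyPow, p.derivOrder) := by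
  have hle : ∀ p : JetIdx r n, p.airyPow * r + p.derivOrder ≤ r * n := fun p => by
    rw [← jetEquiv_val]
    exact Nat.lt_succ_iff.1 (jetEquiv r n p).isLt
  symm
  refine Finset.sum_bij (fun p _ => (p.airyPow, p.derivOrder)) ?_ ?_ ?_ fun _ _ => rfl
  · intro p _
    have h1 : p.airyPow ≤ n := by
      rcases p with q | q
      · exact q.2.isLt.le
      · exact le_rfl
    simp only [idxSet, Finset.mem_filter, Finset.mem_product, Finset.mem_range]
    exact ⟨⟨by omega, p.derivOrder_lt hr⟩, hle p⟩
  · intro p _ p' _ h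
    rw [Prod.mk.injEq] at h
    refine (jetEquiv r n).injective (Fin.ext ?_)
    rw [jetEquiv_val, jetEquiv_val, h.1, h.2]
  · rintro ⟨i, j⟩ hq
    simp only [idxSet, Finset.mem_filter, Finset.mem_product, Finset.mem_range] at hq
    let p := (jetEquiv r n).symm ⟨i * r + j, by omega⟩
    have hp : p.airyPow * r + p.derivOrder = i * r + j := by
      rw [← jetEquiv_val, Equiv.apply_symm_apply]
    have hj : p.derivOrder = j := by
      have := congrArg (· % r) hp
      simpa [Nat.mod_eq_of_lt (p.derivOrder_lt hr), Nat.mod_eq_of_lt hq.1.2] using this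
    have hi : p.airyPow = i := Nat.eq_of_mul_eq_mul_right hr (by omega)
    exact ⟨p, Finset.mem_univ _, by rw [hi, hj]⟩

/-- The operator `(d/dx)^j L₀^i` with the given index. -/
noncomputable def jetOp (r n : ℕ) (a : ℕ → ℂ) (p : JetIdx r n) (u : ℂ → ℂ) : ℂ → ℂ :=
  iteratedDeriv p.derivOrder ((airyOp r a)^[p.airyPow] u)

lemma isDiffOp_jetOp (hr : 2 ≤ r) (a : ℕ → ℂ) (p : JetIdx r n) :
    IsDiffOp (jetEquiv r n p).val 1 (jetOp r n a p) := by
  rw [jetEquiv_val]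
  exact isDiffOp_iteratedDeriv_airyOp hr a p.airyPow p.derivOrder

lemma exists_jetOp_matrix (hr : 2 ≤ r) (n : ℕ) (a : ℕ → ℂ) (x : ℂ) :
    ∃ T : Matrix (Fin (r * n + 1)) (Fin (r * n + 1)) ℂ, T.det = 1 ∧
      ∀ u, Differentiable ℂ u → ∀ p : JetIdx r n,
        jetOp r n a p u x = ∑ m, T (jetEquiv r n p) m * iteratedDeriv m.val u x := by
  choose t ht1 ht2 using fun p : JetIdx r n => isDiffOp_jetOp hr a p
  refine ⟨Matrix.of fun i m => if m ≤ i then (t ((jetEquiv r n).symm i) m).eval x else 0,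
    ?_, fun u hu p => ?_⟩
  · rw [Matrix.det_of_isLowerTriangular]
    · refine Finset.prod_eq_one fun i _ => ?_
      have := ht1 ((jetEquiv r n).symm i)
      rw [Equiv.apply_symm_apply] at this
      simp [this]
    · intro i j hij
      have : ¬ j ≤ i := not_le.2 hij
      simp [this]
  · rw [ht2 p u hu x]
    simp only [Matrix.of_apply, Equiv.symm_apply_apply, ite_mul, zero_mul, Fin.le_def]
    rw [Fin.sum_univ_eq_sum_range (fun m => if m ≤ (jetEquiv r n p).val then
      (t p m).eval x * iteratedDeriv m u x else 0) (r * n + 1), ← Finset.sum_filter]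
    refine Finset.sum_congr ?_ fun _ _ => rfl
    ext m
    have := (jetEquiv r n p).isLt
    simp only [Finset.mem_range, Finset.mem_filter]
    omega

/-- The jet operators of an entire function take arbitrary values at a point. -/
lemma exists_jetOp_eq (hr : 2 ≤ r) (a : ℕ → ℂ) (x : ℂ) (y : JetIdx r n → ℂ) :
    ∃ u, Differentiable ℂ u ∧ ∀ p, jetOp r n a p u x = y p := by
  obtain ⟨T, hT, h⟩ := exists_jetOp_matrix hr n a x
  let z : Fin (r * n + 1) → ℂ := T⁻¹.mulVec fun i => y ((jetEquiv r n).symm i)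
  obtain ⟨u, hu, hz⟩ := exists_entire_jet (r * n + 1) x
    fun m => if hm : m < r * n + 1 then z ⟨m, hm⟩ else 0
  refine ⟨u, hu, fun p => ?_⟩
  have h1 : T.mulVec z (jetEquiv r n p) = y p := by
    rw [Matrix.mulVec_mulVec, Matrix.mul_nonsing_inv _ (by simp [hT]), Matrix.one_mulVec,
      Equiv.symm_apply_apply]
  rw [h u hu p, ← h1]
  exact Finset.sum_congr rfl fun m _ => by rw [hz m m.isLt, dif_pos m.isLt]

lemma jetOp_taylorMonomial (hr : 2 ≤ r) (a : ℕ → ℂ) (x : ℂ) :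
    (fun p => jetOp r n a p (taylorMonomial x (r * n)) x) =
      (Sum.elim 0 1 : JetIdx r n → ℂ) := by
  ext p
  obtain ⟨t, ht, hP⟩ := isDiffOp_jetOp hr a p
  rcases p with q | q
  · obtain ⟨k, hk, -, -⟩ := jetEquiv_inl q
    rw [hP _ (differentiable_taylorMonomial _ _)]
    refine Finset.sum_eq_zero fun m hm => ?_
    have := k.isLt
    rw [hk, Finset.mem_range, Fin.val_castSucc] at hm
    rw [iteratedDeriv_taylorMonomial, if_neg (by omega), mul_zero]
  · rw [jetEquiv_inr] at ht hP
    refine (hP.apply_taylorMonomial le_rfl x).trans ?_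
    simp only [Fin.val_last] at ht
    simp [ht]

end JetOperators

section Factorization

variable {r n : ℕ} {a : ℕ → ℂ} {f : ℕ → ℂ → ℂ}

lemma phiFam_eq (lam gam : ℕ → ℂ) (k : Fin (r * n)) :
    phiFam r n f lam gam k = fun x => gam (k.val / r) * f (k.val % r) (x + lam (k.val / r)) +
      1 * deriv (f (k.val % r)) (x + lam (k.val / r)) := by
  funext x
  rw [one_mul, phiFam]

lemma differentiable_phiFam (hr : 0 < r) (hf : ∀ j < r, Differentiable ℂ (f j)) (lam gam : ℕ → ℂ)
    (k : Fin (r * n)) : Differentiable ℂ (phiFam r n f lam gam k) := by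
  have h := hf _ (Nat.mod_lt k.val hr)
  have hs : Differentiable ℂ fun x => x + lam (k.val / r) := differentiable_id.add_const _
  exact ((h.comp hs).const_mul _).add ((differentiable_deriv_complex h).comp hs)

/-- The bordered Wronskian of the family `φ` is a polynomial in `x` and in the jets of `u`. -/
lemma wrDetB_phiFam (hr : 2 ≤ r) (hf : ∀ j < r, Differentiable ℂ (f j))
    (hker : ∀ j < r, ∀ x : ℂ, airyOp r a (f j) x = 0)
    (hwrf : ∀ x : ℂ, wrDet r (fun j => f j.val) x = 1) (lam gam : ℕ → ℂ) {u : ℂ → ℂ}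
    (hu : Differentiable ℂ u) (x : ℂ) :
    wrDetB (r * n) (phiFam r n f lam gam) u x =
      (borderedMatrix r n a lam gam fun p => jetOp r n a p u x).det.eval x := by
  have hr0 : 0 < r := by omega
  obtain ⟨T, hT, h⟩ := exists_jetOp_matrix hr n a x
  let g : Fin (r * n + 1) → ℂ → ℂ := Fin.snoc (phiFam r n f lam gam) u
  have hg : ∀ s, Differentiable ℂ (g s) := snoc_differentiable (differentiable_phiFam hr0 hf _ _) hu
  let A : Matrix (JetIdx r n) (JetIdx r n) ℂ :=
    Matrix.of fun p q => jetOp r n a p (g (jetEquiv r n q)) x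
  have hA1 : A.det = wrDetB (r * n) (phiFam r n f lam gam) u x := by
    have : A = (T * Matrix.of fun k s : Fin (r * n + 1) => iteratedDeriv k.val (g s) x).submatrix
        (jetEquiv r n) (jetEquiv r n) := by
      ext p q
      simp only [A, Matrix.of_apply, Matrix.submatrix_apply, Matrix.mul_apply]
      exact h _ (hg _) p
    rw [this, Matrix.det_submatrix_equiv_self, Matrix.det_mul, hT, one_mul]
    rfl
  let B : Fin n → Matrix (Fin r) (Fin r) ℂ := fun l =>
    Matrix.of fun m j => iteratedDeriv m.val (f j.val) (x + lam l)
  have hA2 : A = ((borderedMatrix r n a lam gam fun p => jetOp r n a p u x).map (eval x)) *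
      Matrix.fromBlocks (Matrix.blockDiagonal B) 0 0 1 := by
    ext p q
    rw [Matrix.mul_apply, Fintype.sum_sum_type]
    rcases q with ⟨j, l⟩ | q
    · obtain ⟨k, hk, h1, h2⟩ := jetEquiv_inl (j, l)
      have hj := j.isLt
      simp only [A, Matrix.of_apply, hk, g, Fin.snoc_castSucc, phiFam_eq, h1, h2]
      rw [jetOp, iteratedDeriv_airyOp_iterate_lin_comb_shift (hf j hj) (hker j hj)]
      simp only [Matrix.fromBlocks_apply₁₁, Matrix.fromBlocks_apply₂₁, Matrix.zero_apply, mul_zero,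
        Finset.sum_const_zero, add_zero, Fintype.sum_prod_type, Matrix.blockDiagonal_apply,
        Matrix.map_apply, mul_ite, Finset.sum_ite_eq', Finset.mem_univ, if_true, one_mul]
      simp only [borderedMatrix, Matrix.of_apply, Sum.elim_inl, eval_add, eval_mul, eval_C,
        add_mul, Finset.sum_add_distrib]
      generalize gam l * lam l ^ p.airyPow + p.airyPow * lam l ^ (p.airyPow - 1) = α
      generalize lam l ^ p.airyPow = β
      have hp := p.derivOrder_lt hr0
      have hsum : ∀ (i : ℕ) (hi : i < r) (v : Fin r → ℂ),
          ∑ m : Fin r, (if m.val = i then 1 else 0) * v m = v ⟨i, hi⟩ := by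
        intro i hi v
        rw [Finset.sum_eq_single ⟨i, hi⟩]
        · simp
        · intro m _ hm
          rw [if_neg fun h => hm (Fin.ext h), zero_mul]
        · simp
      congr 1
      · simp only [apply_ite (eval x), eval_one, eval_zero, mul_assoc, ← Finset.mul_sum]
        rw [hsum _ hp]
        rfl
      · by_cases hp' : p.derivOrder + 1 < r
        · simp only [hp', if_true, apply_ite (eval x), eval_one, eval_zero, mul_assoc,
            ← Finset.mul_sum]
          rw [hsum _ hp']
          rfl
        · have hpr : p.derivOrder + 1 = 0 + r := by omega
          simp only [hp', if_false, mul_assoc, ← Finset.mul_sum, eval_add, eval_C]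
          rw [hpr, iteratedDeriv_of_airyOp_eq_zero (hf j hj) (hker j hj)]
          have hIco : ∀ v : ℕ → ℂ, ∑ m : Fin r, (if m.val ∈ Finset.Ico 1 (r - 1) then a m.val else 0)
              * v m.val = ∑ m ∈ Finset.Ico 1 (r - 1), a m * v m := by
            intro v
            rw [Fin.sum_univ_eq_sum_range
              (fun m => (if m ∈ Finset.Ico 1 (r - 1) then a m else 0) * v m) r]
            simp only [ite_mul, zero_mul, ← Finset.sum_filter]
            refine Finset.sum_congr ?_ fun _ _ => rfl
            ext m
            simp only [Finset.mem_filter, Finset.mem_range, Finset.mem_Ico]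
            omega
          have hX : ∀ v : Fin r → ℂ, ∑ m : Fin r,
              eval x (if m.val = 0 then X + C (lam l) else 0) * v m = (x + lam l) * v ⟨0, hr0⟩ := by
            intro v
            rw [← hsum 0 hr0 v, Finset.mul_sum]
            refine Finset.sum_congr rfl fun m _ => ?_
            split_ifs <;> simp
          simp only [add_mul, Finset.sum_add_distrib, B, Matrix.of_apply]
          rw [hX, hIco fun m => iteratedDeriv m (f j) (x + lam l)]
          simp [add_mul, add_comm]
    · obtain rfl : q = 0 := Subsingleton.elim _ _
      simp [A, jetEquiv_inr, g, borderedMatrix]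
  have hB : (Matrix.fromBlocks (Matrix.blockDiagonal B) 0 0 (1 : Matrix (Fin 1) (Fin 1) ℂ)).det
      = 1 := by
    rw [Matrix.det_fromBlocks_zero₂₁, Matrix.det_blockDiagonal, Matrix.det_one, mul_one]
    exact Finset.prod_eq_one fun l _ => hwrf (x + lam l)
  rw [← hA1, hA2, Matrix.det_mul, hB, mul_one, ← coe_evalRingHom, ← RingHom.mapMatrix_apply,
    ← RingHom.map_det]

end Factorization

section Expansion

variable {r n : ℕ} {a : ℕ → ℂ} {f : ℕ → ℂ → ℂ} {lam gam : ℕ → ℂ} {K : ℕ → ℕ → ℂ[X]}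

lemma ExpProp.sum_C_mul (hr : 2 ≤ r) (hf : ∀ j < r, Differentiable ℂ (f j))
    (hker : ∀ j < r, ∀ x : ℂ, airyOp r a (f j) x = 0)
    (hwrf : ∀ x : ℂ, wrDet r (fun j => f j.val) x = 1)
    (hK : ExpProp r n a (phiFam r n f lam gam) K) (y : JetIdx r n → ℂ) :
    ∑ p : JetIdx r n, C (y p) * K p.airyPow p.derivOrder =
      (borderedMatrix r n a lam gam y).det := by
  refine Polynomial.funext fun x => ?_
  obtain ⟨u, hu, hy⟩ := exists_jetOp_eq hr a x y
  have h := hK.2 u hu x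
  rw [wrDetB_phiFam hr hf hker hwrf lam gam hu, sum_idxSet (by omega)] at h
  simp only [hy] at h
  rw [h, eval_finsetSum]
  refine Finset.sum_congr rfl fun p _ => ?_
  have := hy p
  rw [jetOp] at this
  rw [eval_mul, eval_C, this, mul_comm]

/-- The coefficients of `x^n` in the expansion of the Wronskian operator. -/
lemma ExpProp.natDegree_le_and_coeff (hr : 2 ≤ r) (hf : ∀ j < r, Differentiable ℂ (f j))
    (hker : ∀ j < r, ∀ x : ℂ, airyOp r a (f j) x = 0)
    (hwrf : ∀ x : ℂ, wrDet r (fun j => f j.val) x = 1)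
    (hK : ExpProp r n a (phiFam r n f lam gam) K) :
    (∀ p : JetIdx r n, (K p.airyPow p.derivOrder).natDegree ≤ n) ∧
      (∀ p : JetIdx r n, p.derivOrder ≠ 0 → (K p.airyPow p.derivOrder).coeff n = 0) ∧
      ∃ ε : ℂ, (ε = 1 ∨ ε = -1) ∧
        ∑ p : JetIdx r n, X ^ p.airyPow * C ((K p.airyPow p.derivOrder).coeff n) =
          C (ε * vand n lam ^ r) * ∏ i ∈ Finset.range n, (X - C (lam i)) := by
  have hdet := hK.sum_C_mul hr hf hker hwrf
  have hsingle : ∀ p : JetIdx r n,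
      K p.airyPow p.derivOrder = (borderedMatrix r n a lam gam (Pi.single p 1)).det := by
    intro p
    rw [← hdet, Finset.sum_eq_single p]
    · simp
    · intro q _ hq
      simp [hq]
    · simp
  obtain ⟨s, hs, hlead⟩ := exists_det_leadingMatrix hr n lam gam
  obtain ⟨s', hs', hvand⟩ := exists_sign_vand n lam
  refine ⟨fun p => ?_, fun p hp => ?_, s * s' ^ r, ?_, ?_⟩
  · rw [hsingle]
    exact (det_borderedMatrix_natDegree_le_and_coeff hr n a lam gam _).1
  · rw [hsingle, (det_borderedMatrix_natDegree_le_and_coeff hr n a lam gam _).2, hlead]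
    have : (fun q : Fin n ⊕ Fin 1 => (Pi.single p 1 : JetIdx r n → ℂ)
        (Sum.map (fun i => (⟨0, by omega⟩, i)) id q)) = 0 := by
      ext q
      refine Pi.single_eq_of_ne (fun h => hp ?_) _
      rw [← h]
      rcases q with q | q <;> rfl
    rw [this, det_borderBlock_zero, mul_zero]
  · rcases hs' with rfl | rfl
    · simpa using hs
    · rcases neg_one_pow_eq_or ℂ r with h | h <;> rcases hs with rfl | rfl <;> simp [h]
  · refine Polynomial.funext fun t => ?_
    have h := congrArg (fun q : ℂ[X] => q.coeff n) (hdet fun p => t ^ p.airyPow)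
    simp only [finsetSum_coeff, coeff_C_mul] at h
    rw [(det_borderedMatrix_natDegree_le_and_coeff hr n a lam gam _).2, hlead] at h
    have hpow : (fun q : Fin n ⊕ Fin 1 =>
        t ^ (JetIdx.airyPow (Sum.map (fun i => ((⟨0, by omega⟩ : Fin r), i)) id q))) =
          fun q => t ^ (Sum.elim (fun i => i.val) (fun _ => n) q : ℕ) := by
      ext q
      rcases q with q | q <;> rfl
    rw [hpow, det_borderBlock_pow, hvand] at h
    simp only [eval_finsetSum, eval_mul, eval_pow, eval_X, eval_C, eval_prod, eval_sub]
    rw [h]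
    obtain ⟨m, rfl⟩ : ∃ m, r = m + 1 := ⟨r - 1, by omega⟩
    simp only [Nat.add_sub_cancel]
    ring

lemma polyOpAiry_eq_sum_range {p : ℂ[X]} (hp : p.natDegree ≤ n) (u : ℂ → ℂ) :
    polyOpAiry r a p u = fun x => ∑ d ∈ Finset.range (n + 1), p.coeff d * (airyOp r a)^[d] u x := by
  ext x
  refine Finset.sum_subset (Finset.range_subset_range.2 (by omega)) fun d _ hd => ?_
  rw [coeff_eq_zero_of_natDegree_lt (by simpa using hd), zero_mul]

lemma isDiffOp_iteratedDeriv_polyOpAiry (hr : 2 ≤ r) {p : ℂ[X]} (hp : p.natDegree ≤ n) {j : ℕ}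
    (hj : j < r) (hpj : j ≠ 0 → p.coeff n = 0) :
    IsDiffOp (r * n) (C (p.coeff n)) fun u => iteratedDeriv j (polyOpAiry r a p u) := by
  have h : IsDiffOp (r * n) (∑ d ∈ Finset.range (n + 1), if d = n then C (p.coeff n) else 0)
      fun u x => ∑ d ∈ Finset.range (n + 1),
        (C (p.coeff d)).eval x * iteratedDeriv j ((airyOp r a)^[d] u) x := by
    refine IsDiffOp.sum _ fun d hd => ?_
    have h := (isDiffOp_iteratedDeriv_airyOp hr a d j).poly_mul (C (p.coeff d))
    split_ifs with hdn
    · subst hdn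
      by_cases hj0 : j = 0
      · simpa [hj0, mul_comm r] using h
      · rw [hpj hj0, C_0]
        simpa using isDiffOp_zero (r * d)
    · refine h.of_lt ?_
      have : d + 1 ≤ n := by have := Finset.mem_range.1 hd; omega
      nlinarith
  rw [Finset.sum_ite_eq' _ n, if_pos (Finset.self_mem_range_succ n)] at h
  refine h.congr fun u hu x => ?_
  have hd : ∀ d, Differentiable ℂ fun x => p.coeff d * (airyOp r a)^[d] u x := fun d =>
    (differentiable_airyOp_iterate hr a d hu).const_mul _
  rw [polyOpAiry_eq_sum_range hp, iteratedDeriv_fun_sum fun d _ => (hd d).contDiff.contDiffAt]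
  simp only [iteratedDeriv_const_mul_field, eval_C]

lemma Fop_eq_sum (hr : 0 < r) (u : ℂ → ℂ) (x : ℂ) :
    Fop r n a K u x = ∑ p : JetIdx r n,
      x ^ p.airyPow * iteratedDeriv p.derivOrder (polyOpAiry r a (K p.airyPow p.derivOrder) u) x :=
  sum_idxSet hr fun q => x ^ q.1 * iteratedDeriv q.2 (polyOpAiry r a (K q.1 q.2) u) x

lemma ExpProp.isDiffOp_Fop (hr : 2 ≤ r) (hf : ∀ j < r, Differentiable ℂ (f j))
    (hker : ∀ j < r, ∀ x : ℂ, airyOp r a (f j) x = 0)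
    (hwrf : ∀ x : ℂ, wrDet r (fun j => f j.val) x = 1)
    (hK : ExpProp r n a (phiFam r n f lam gam) K) :
    ∃ ε : ℂ, (ε = 1 ∨ ε = -1) ∧ IsDiffOp (r * n)
      (C (ε * vand n lam ^ r) * ∏ i ∈ Finset.range n, (X - C (lam i))) (Fop r n a K) := by
  obtain ⟨h1, h2, ε, hε, h3⟩ := hK.natDegree_le_and_coeff hr hf hker hwrf
  refine ⟨ε, hε, ?_⟩
  rw [← h3]
  refine (IsDiffOp.sum Finset.univ fun p _ => (isDiffOp_iteratedDeriv_polyOpAiry (a := a) hr (h1 p)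
    (p.derivOrder_lt (by omega)) (h2 p)).poly_mul (X ^ p.airyPow)).congr fun u _ x => ?_
  rw [Fop_eq_sum (by omega)]
  simp

/-- Applying `♭` exchanges the spectral parameter and the space variable. -/
lemma ExpProp.Fop_lin_comb_shift (hr : 0 < r) {g : ℂ → ℂ} (hg : Differentiable ℂ g)
    (hgker : ∀ x, airyOp r a g x = 0) {φ : Fin (r * n) → ℂ → ℂ} (hK : ExpProp r n a φ K)
    (γ μ x : ℂ) :
    Fop r n a K (fun x => γ * g (x + μ) + 1 * deriv g (x + μ)) x =
      deriv (wrDetB (r * n) φ fun z => 1 * g (z + x) + 0 * deriv g (z + x)) μ +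
        γ * wrDetB (r * n) φ (fun z => 1 * g (z + x) + 0 * deriv g (z + x)) μ := by
  have hs : Differentiable ℂ fun z => z + x := differentiable_id.add_const _
  have hu : Differentiable ℂ fun z => 1 * g (z + x) + 0 * deriv g (z + x) :=
    ((hg.comp hs).const_mul _).add (((differentiable_deriv_complex hg).comp hs).const_mul _)
  have hW : (wrDetB (r * n) φ fun z => 1 * g (z + x) + 0 * deriv g (z + x)) = fun z =>
      ∑ p : JetIdx r n, (K p.airyPow p.derivOrder).eval z *
        (x ^ p.airyPow * iteratedDeriv p.derivOrder g (z + x)) := by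
    ext z
    rw [hK.2 _ hu z, sum_idxSet hr]
    refine Finset.sum_congr rfl fun p _ => ?_
    rw [iteratedDeriv_airyOp_iterate_lin_comb_shift hg hgker]
    ring
  have hder : ∀ p : JetIdx r n, HasDerivAt (fun z => (K p.airyPow p.derivOrder).eval z *
      (x ^ p.airyPow * iteratedDeriv p.derivOrder g (z + x)))
      ((K p.airyPow p.derivOrder).derivative.eval μ *
          (x ^ p.airyPow * iteratedDeriv p.derivOrder g (μ + x)) +
        (K p.airyPow p.derivOrder).eval μ *
          (x ^ p.airyPow * iteratedDeriv (p.derivOrder + 1) g (μ + x))) μ := fun p =>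
    ((K p.airyPow p.derivOrder).hasDerivAt μ).mul
      (((hg.hasDerivAt_iteratedDeriv p.derivOrder (μ + x)).comp_add_const μ x).const_mul _)
  rw [hW, (HasDerivAt.fun_sum fun p _ => hder p).deriv, Fop_eq_sum hr, Finset.mul_sum,
    ← Finset.sum_add_distrib]
  refine Finset.sum_congr rfl fun p _ => ?_
  rw [polyOpAiry_lin_comb_shift hg hgker]
  have h := iteratedDeriv_lin_comb_shift hg (γ * (K p.airyPow p.derivOrder).eval μ +
    1 * (K p.airyPow p.derivOrder).derivative.eval μ) (1 * (K p.airyPow p.derivOrder).eval μ) μ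
    p.derivOrder x
  rw [h, add_comm x μ]
  ring

lemma ExpProp.deriv_Fop_shift (hr : 0 < r) {g : ℂ → ℂ} (hg : Differentiable ℂ g)
    (hgker : ∀ x, airyOp r a g x = 0) {φ : Fin (r * n) → ℂ → ℂ} (hK : ExpProp r n a φ K)
    (γ μ x : ℂ) :
    deriv (Fop r n a K fun z => 1 * g (z + x) + 0 * deriv g (z + x)) μ +
        γ * Fop r n a K (fun z => 1 * g (z + x) + 0 * deriv g (z + x)) μ =
      wrDetB (r * n) φ (fun x => γ * g (x + μ) + 1 * deriv g (x + μ)) x := by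
  have hs : Differentiable ℂ fun z => z + μ := differentiable_id.add_const _
  have hu : Differentiable ℂ fun x => γ * g (x + μ) + 1 * deriv g (x + μ) :=
    ((hg.comp hs).const_mul _).add (((differentiable_deriv_complex hg).comp hs).const_mul _)
  have hF : (Fop r n a K fun z => 1 * g (z + x) + 0 * deriv g (z + x)) = fun z =>
      ∑ p : JetIdx r n, z ^ p.airyPow *
        ((K p.airyPow p.derivOrder).eval x * iteratedDeriv p.derivOrder g (z + x)) := by
    ext z
    rw [Fop_eq_sum hr]
    refine Finset.sum_congr rfl fun p _ => ?_
    rw [polyOpAiry_lin_comb_shift hg hgker, iteratedDeriv_lin_comb_shift hg]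
    ring
  have hder : ∀ p : JetIdx r n, HasDerivAt (fun z => z ^ p.airyPow *
      ((K p.airyPow p.derivOrder).eval x * iteratedDeriv p.derivOrder g (z + x)))
      (p.airyPow * μ ^ (p.airyPow - 1) *
          ((K p.airyPow p.derivOrder).eval x * iteratedDeriv p.derivOrder g (μ + x)) +
        μ ^ p.airyPow *
          ((K p.airyPow p.derivOrder).eval x * iteratedDeriv (p.derivOrder + 1) g (μ + x))) μ :=
    fun p => (hasDerivAt_pow p.airyPow μ).mul
      (((hg.hasDerivAt_iteratedDeriv p.derivOrder (μ + x)).comp_add_const μ x).const_mul _)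
  rw [hF, (HasDerivAt.fun_sum fun p _ => hder p).deriv, hK.2 _ hu x, sum_idxSet hr, Finset.mul_sum,
    ← Finset.sum_add_distrib]
  refine Finset.sum_congr rfl fun p _ => ?_
  rw [iteratedDeriv_airyOp_iterate_lin_comb_shift hg hgker, add_comm x μ]
  ring

end Expansion

section Bispectrality

variable {r n : ℕ} {a : ℕ → ℂ} {f : ℕ → ℂ → ℂ} {lam gam mu gam' : ℕ → ℂ} {K : ℕ → ℕ → ℂ[X]}

lemma continuous_wrDetB {N : ℕ} {g : Fin N → ℂ → ℂ} (hg : ∀ s, Differentiable ℂ (g s))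
    {u : ℂ → ℂ} (hu : Differentiable ℂ u) : Continuous (wrDetB N g u) := by
  refine Continuous.matrix_det (continuous_matrix fun k s => ?_)
  exact ((snoc_differentiable hg hu s).iteratedDeriv_complex k.val).continuous

/-- The Wronskian of the family `φ` is a polynomial of degree `n`. -/
lemma exists_wrDet_phiFam_eq (hr : 2 ≤ r) (hf : ∀ j < r, Differentiable ℂ (f j))
    (hker : ∀ j < r, ∀ x : ℂ, airyOp r a (f j) x = 0)
    (hwrf : ∀ x : ℂ, wrDet r (fun j => f j.val) x = 1)
    (hmu : ∀ k < n, ∀ l < n, k ≠ l → mu k ≠ mu l) (gam' : ℕ → ℂ) :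
    ∃ W : ℂ[X], W.natDegree ≤ n ∧ W.coeff n ≠ 0 ∧
      ∀ x, wrDet (r * n) (phiFam r n f mu gam') x = W.eval x := by
  have hdet := det_borderedMatrix_natDegree_le_and_coeff hr n a mu gam' (Sum.elim 0 1 : JetIdx r n → ℂ)
  refine ⟨_, hdet.1, ?_, fun x => ?_⟩
  · obtain ⟨s, hs, hlead⟩ := exists_det_leadingMatrix hr n mu gam'
    obtain ⟨s', hs', hvand⟩ := exists_sign_vand n mu
    have hV : vandermondeProd n mu ≠ 0 := by
      rw [hvand]
      refine mul_ne_zero ?_ (vand_ne_zero hmu)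
      rcases hs' with rfl | rfl <;> simp
    have hy : (fun q : Fin n ⊕ Fin 1 => (Sum.elim 0 1 : JetIdx r n → ℂ)
        (Sum.map (fun i => (⟨0, by omega⟩, i)) id q)) = (Sum.elim 0 1 : Fin n ⊕ Fin 1 → ℂ) := by
      ext q
      rcases q with q | q <;> rfl
    rw [hdet.2, hlead, hy, det_borderBlock_single]
    refine mul_ne_zero (mul_ne_zero ?_ (pow_ne_zero _ hV)) hV
    rcases hs with rfl | rfl <;> simp
  · rw [← wrDetB_taylorMonomial, wrDetB_phiFam hr hf hker hwrf mu gam'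
      (differentiable_taylorMonomial _ _), jetOp_taylorMonomial hr]

lemma exists_ne_zero_of_wrDet_eq_one (hr : 0 < r)
    (hwrf : ∀ x : ℂ, wrDet r (fun j => f j.val) x = 1) : ∃ j < r, ∃ x, f j x ≠ 0 := by
  by_contra! h
  have h0 : wrDet r (fun j => f j.val) 0 = 0 :=
    Matrix.det_eq_zero_of_row_eq_zero ⟨0, hr⟩ fun j => by simp [h j.val j.isLt]
  rw [hwrf] at h0
  exact one_ne_zero h0

lemma ExpProp.Fop_phiFam_eq_zero (hr : 0 < r) (hf : ∀ j < r, Differentiable ℂ (f j))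
    (hker : ∀ j < r, ∀ x : ℂ, airyOp r a (f j) x = 0) {φ : Fin (r * n) → ℂ → ℂ}
    (hgam' : ∀ k < n, ∀ u : ℂ → ℂ, Differentiable ℂ u →
      deriv (wrDetB (r * n) φ u) (mu k) + gam' k * wrDetB (r * n) φ u (mu k) = 0)
    (hK : ExpProp r n a φ K) (k : Fin (r * n)) (x : ℂ) :
    Fop r n a K (phiFam r n f mu gam' k) x = 0 := by
  have hj := Nat.mod_lt k.val hr
  have hs : Differentiable ℂ fun z => z + x := differentiable_id.add_const _
  rw [phiFam_eq, hK.Fop_lin_comb_shift hr (hf _ hj) (hker _ hj)]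
  refine hgam' _ (Nat.div_lt_of_lt_mul k.isLt) _ ?_
  exact (((hf _ hj).comp hs).const_mul _).add
    (((differentiable_deriv_complex (hf _ hj)).comp hs).const_mul _)

lemma derivative_C_mul_prod_eval_ne_zero {e : ℂ} (he : e ≠ 0)
    (hlam : ∀ i < n, ∀ j < n, i ≠ j → lam i ≠ lam j) {l : ℕ} (hl : l < n) :
    (derivative (C e * ∏ i ∈ Finset.range n, (X - C (lam i)))).eval (lam l) ≠ 0 := by
  rw [← Finset.mul_prod_erase _ _ (Finset.mem_range.2 hl), derivative_C_mul, derivative_mul,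
    derivative_X_sub_C]
  simp only [eval_mul, eval_add, eval_sub, eval_C, eval_X, sub_self, zero_mul, add_zero, one_mul,
    eval_prod]
  refine mul_ne_zero he (Finset.prod_ne_zero_iff.2 fun i hi => sub_ne_zero.2 ?_)
  rw [Finset.mem_erase, Finset.mem_range] at hi
  exact hlam l hl i hi.2 hi.1.symm

/-- The Wronskian of the `β`-transformed family vanishes at the original points. -/
lemma ExpProp.wrDet_phiFam_eq_zero (hr : 2 ≤ r) (hf : ∀ j < r, Differentiable ℂ (f j))
    (hker : ∀ j < r, ∀ x : ℂ, airyOp r a (f j) x = 0)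
    (hwrf : ∀ x : ℂ, wrDet r (fun j => f j.val) x = 1)
    (hlam : ∀ i < n, ∀ j < n, i ≠ j → lam i ≠ lam j)
    (hgam' : ∀ k < n, ∀ u : ℂ → ℂ, Differentiable ℂ u →
      deriv (wrDetB (r * n) (phiFam r n f lam gam) u) (mu k)
        + gam' k * wrDetB (r * n) (phiFam r n f lam gam) u (mu k) = 0)
    (hK : ExpProp r n a (phiFam r n f lam gam) K) {l : ℕ} (hl : l < n) :
    wrDet (r * n) (phiFam r n f mu gam') (lam l) = 0 := by
  have hr0 : 0 < r := by omega
  obtain ⟨ε, hε, t, ht, hF⟩ := hK.isDiffOp_Fop hr hf hker hwrf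
  have hV : ε * vand n lam ^ r ≠ 0 := by
    refine mul_ne_zero ?_ (pow_ne_zero _ (vand_ne_zero hlam))
    rcases hε with rfl | rfl <;> simp
  by_contra hW
  have hFl : ∀ u, Differentiable ℂ u → Fop r n a K u (lam l) = 0 := by
    intro u hu
    have h := hF.mul_wrDetB (differentiable_phiFam hr0 hf mu gam') hu (lam l)
      fun s => hK.Fop_phiFam_eq_zero hr0 hf hker hgam' s _
    have h0 : (t (r * n)).eval (lam l) = 0 := by
      rw [ht, eval_mul, eval_prod, Finset.prod_eq_zero (Finset.mem_range.2 hl), mul_zero]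
      simp
    rw [h0, zero_mul] at h
    exact (mul_eq_zero.1 h.symm).resolve_left hW
  have htl : ∀ k ≤ r * n, (t k).eval (lam l) = 0 := fun k hk => by
    rw [← hF.apply_taylorMonomial hk, hFl _ (differentiable_taylorMonomial _ _)]
  obtain ⟨j, hj, x₀, hx₀⟩ := exists_ne_zero_of_wrDet_eq_one hr0 hwrf
  let p : ℂ[X] := ∑ k ∈ Finset.range (r * n + 1), C ((t k).derivative.eval (lam l)) * X ^ k
  have hcoeff : ∀ k ≤ r * n, p.coeff k = (t k).derivative.eval (lam l) := by
    intro k hk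
    simp only [p, finsetSum_coeff, coeff_C_mul_X_pow]
    rw [Finset.sum_ite_eq, if_pos (Finset.mem_range.2 (by omega))]
  have hp : p = 0 := by
    refine eq_zero_of_constCoeff_annihilates (hf j hj) (hker j hj) hx₀ (r * n) p ?_ fun z => ?_
    · refine natDegree_sum_le_of_forall_le _ _ fun k hk => (natDegree_C_mul_X_pow_le _ _).trans ?_
      have := Finset.mem_range.1 hk
      omega
    · have hs : Differentiable ℂ fun y => y + (z - lam l) := differentiable_id.add_const _
      have hu : Differentiable ℂ fun y => 1 * f j (y + (z - lam l)) +
          0 * deriv (f j) (y + (z - lam l)) :=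
        (((hf j hj).comp hs).const_mul _).add
          (((differentiable_deriv_complex (hf j hj)).comp hs).const_mul _)
      have h := hK.deriv_Fop_shift hr0 (hf j hj) (hker j hj) (gam l) (lam l) (z - lam l)
      obtain ⟨k, -, hk1, hk2⟩ := jetEquiv_inl ((⟨j, hj⟩, ⟨l, hl⟩) : Fin r × Fin n)
      have hφ := phiFam_eq (f := f) lam gam k
      rw [hk1, hk2] at hφ
      rw [← hφ, wrDetB_self, hFl _ hu, mul_zero, add_zero, (hF.hasDerivAt hu _).deriv] at h
      rw [← h]
      refine Finset.sum_congr rfl fun m hm => ?_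
      have hm' : m ≤ r * n := by have := Finset.mem_range.1 hm; omega
      rw [iteratedDeriv_lin_comb_shift (hf j hj), htl m hm', hcoeff m hm', add_sub_cancel]
      ring
  have h := hcoeff _ le_rfl
  rw [hp, coeff_zero, ht] at h
  exact derivative_C_mul_prod_eval_ne_zero hV hlam hl h.symm

lemma eq_C_mul_prod_of_eval_eq_zero {W : ℂ[X]} (hW : W.natDegree ≤ n)
    (hlam : ∀ i < n, ∀ j < n, i ≠ j → lam i ≠ lam j) (h : ∀ i < n, W.eval (lam i) = 0) :
    W = C (W.coeff n) * ∏ i ∈ Finset.range n, (X - C (lam i)) := by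
  have hmonic : (∏ i ∈ Finset.range n, (X - C (lam i))).Monic :=
    monic_prod_X_sub_C _ _
  have hdeg : (∏ i ∈ Finset.range n, (X - C (lam i))).natDegree = n := by
    rw [natDegree_prod_of_monic _ _ fun i _ => monic_X_sub_C _]
    simp
  refine sub_eq_zero.1 (eq_zero_of_degree_lt_of_eval_index_eq_zero (Finset.range n)
    (v := lam) ?_ ?_ ?_)
  · intro i hi j hj hij
    by_contra hne
    exact hlam i (by simpa using hi) j (by simpa using hj) hne hij
  · rw [Finset.card_range, degree_lt_iff_coeff_zero]
    intro m hm
    rcases hm.eq_or_lt with rfl | hm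
    · have h1 := hmonic.coeff_natDegree
      rw [hdeg] at h1
      rw [coeff_sub, coeff_C_mul, h1, mul_one, sub_self]
    · have h1 : W.coeff m = 0 := coeff_eq_zero_of_natDegree_lt (by omega)
      have h2 : (∏ i ∈ Finset.range n, (X - C (lam i))).coeff m = 0 :=
        coeff_eq_zero_of_natDegree_lt (by omega)
      rw [coeff_sub, coeff_C_mul, h1, h2, mul_zero, sub_zero]
  · intro i hi
    rw [eval_sub, h i (Finset.mem_range.1 hi), eval_mul, eval_prod, Finset.prod_eq_zero hi]
    · simp
    · simp

end Bispectrality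

theorem statement4 (r n : ℕ) (a : ℕ → ℂ) (f : ℕ → ℂ → ℂ) (lam gam : ℕ → ℂ)
    (hr : 2 ≤ r) (hn : 1 ≤ n)
    (hf : ∀ j < r, Differentiable ℂ (f j))
    (hker : ∀ j < r, ∀ x : ℂ, airyOp r a (f j) x = 0)
    (hwrf : ∀ x : ℂ, wrDet r (fun j => f j.val) x = 1)
    (hlam : ∀ i < n, ∀ j < n, i ≠ j → lam i ≠ lam j)
    (mu gam' : ℕ → ℂ)
    (hmu : ∀ k < n, ∀ l < n, k ≠ l → mu k ≠ mu l)
    (hroots : ∀ x : ℂ, wrDet (r * n) (phiFam r n f lam gam) x = 0 ↔ ∃ k < n, x = mu k)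
    (hgam' : ∀ k < n, ∀ u : ℂ → ℂ, Differentiable ℂ u →
      deriv (wrDetB (r * n) (phiFam r n f lam gam) u) (mu k)
        + gam' k * wrDetB (r * n) (phiFam r n f lam gam) u (mu k) = 0)
    (K : ℕ → ℕ → Polynomial ℂ)
    (hK : ExpProp r n a (phiFam r n f lam gam) K) :
    (∃ κ : ℂ, κ ≠ 0 ∧ ∀ u : ℂ → ℂ, Differentiable ℂ u → ∀ x : ℂ,
      Fop r n a K u x = κ * wrDetB (r * n) (phiFam r n f mu gam') u x) ∧
    ∀ C : ℕ → Polynomial ℂ,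
      (∀ u : ℂ → ℂ, Differentiable ℂ u → ∀ x : ℂ,
        Fop r n a K u x
          = ∑ k ∈ Finset.range (r * n + 1), (C k).eval x * iteratedDeriv k u x) →
      (C (r * n) = Polynomial.C (vand n lam ^ r)
            * ∏ i ∈ Finset.range n, (Polynomial.X - Polynomial.C (lam i)) ∨
       C (r * n) = -(Polynomial.C (vand n lam ^ r)
            * ∏ i ∈ Finset.range n, (Polynomial.X - Polynomial.C (lam i)))) := by
  have hr0 : 0 < r := by omega
  obtain ⟨ε, hε, hF⟩ := hK.isDiffOp_Fop hr hf hker hwrf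
  refine ⟨?_, fun C hC => ?_⟩
  · obtain ⟨t, ht, hFt⟩ := hF
    obtain ⟨W, hWdeg, hWn, hW⟩ := exists_wrDet_phiFam_eq hr hf hker hwrf hmu gam'
    have hWq := eq_C_mul_prod_of_eval_eq_zero hWdeg hlam fun l hl => by
      rw [← hW, hK.wrDet_phiFam_eq_zero hr hf hker hwrf hlam hgam' hl]
    have he : ε * vand n lam ^ r ≠ 0 := by
      refine mul_ne_zero ?_ (pow_ne_zero _ (vand_ne_zero hlam))
      rcases hε with rfl | rfl <;> simp
    refine ⟨ε * vand n lam ^ r / W.coeff n, div_ne_zero he hWn, fun u hu => congrFun ?_⟩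
    have hφ := differentiable_phiFam (n := n) hr0 hf mu gam'
    have hdense : Dense (((Finset.range n).image lam : Set ℂ)ᶜ) :=
      ((Finset.range n).image lam).countable_toSet.dense_compl ℝ
    refine Continuous.ext_on hdense (hFt.differentiable hu).continuous
      (continuous_const.mul (continuous_wrDetB hφ hu)) fun x hx => ?_
    have h := hFt.mul_wrDetB hφ hu x fun s => hK.Fop_phiFam_eq_zero hr0 hf hker hgam' s _
    have hq : (∏ i ∈ Finset.range n, (X - Polynomial.C (lam i))).eval x ≠ 0 := by
      rw [eval_prod]
      refine Finset.prod_ne_zero_iff.2 fun i hi h0 => hx ?_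
      rw [eval_sub, eval_X, eval_C, sub_eq_zero] at h0
      exact Finset.mem_coe.2 (Finset.mem_image.2 ⟨i, hi, h0.symm⟩)
    rw [ht, hW, congrArg (eval x) hWq, eval_mul, eval_mul, eval_C, eval_C] at h
    refine mul_left_cancel₀ (mul_ne_zero hWn hq) ?_
    rw [← h]
    field_simp
  · obtain ⟨t, ht, hFt⟩ := hF
    have h := HasSymbol.congr_coeff (t := C) (t' := t) hC hFt (le_refl (r * n))
    rw [h, ht]
    rcases hε with rfl | rfl
    · left
      rw [one_mul]
    · right
      rw [neg_one_mul, Polynomial.C_neg, neg_mul]
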